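/- In Λ, there are exactly 32 vectors of the form D = C + aF − b₁E₁ − ⋯ − b₆E₆, with a a non-negative integer and each b_i ∈ {0, 1}, satisfying D·D = −1, namely: the six vectors C − E_i (1 ≤ i ≤ 6), the twenty vectors C + F − E_i − E_j − E_k (1 ≤ i < j < k ≤ 6), and the six vectors C + 2F − E₁ − ⋯ − E₆ + E_j (1 ≤ j ≤ 6). -/

import Mathlib

/-- The Picard lattice of a relatively minimal conic bundle with six degenerate
fibres: the free abelian group with basis `C, F, E₁, …, E₆`, realised as
`Fin 8 → ℤ`. -/
abbrev Lam : Type := Fin 8 → ℤ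

/-- The basis vector `C`. -/
def Cv : Lam := Pi.single 0 1

/-- The basis vector `F`. -/
def Fv : Lam := Pi.single 1 1

/-- The basis vector `E_{i+1}` of the paper, for `i : Fin 6`. -/
def Ev (i : Fin 6) : Lam := Pi.single i.succ.succ 1

/-- The intersection form: `C·C = 0`, `C·F = 1`, `F·F = 0`, `E_i·E_i = −1`, and
all other products of distinct basis vectors are `0`. -/
def ip (v w : Lam) : ℤ :=
  v 0 * w 1 + v 1 * w 0 - ∑ i : Fin 6, v i.succ.succ * w i.succ.succ

/-- The set of vectors `D = C + aF − b₁E₁ − ⋯ − b₆E₆` (with `a` a non-negative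
integer and each `b_i ∈ {0, 1}`) satisfying `D·D = −1`. -/
def negSections : Set Lam :=
  {D | ∃ (a : ℕ) (b : Fin 6 → ℤ), (∀ i, b i = 0 ∨ b i = 1) ∧
    D = Cv + (a : ℤ) • Fv - ∑ i, b i • Ev i ∧
    ip D D = -1}

/-- The vector `C + aF - ∑ i ∈ s, E_i`. -/
def sectionClass (a : ℤ) (s : Finset (Fin 6)) : Lam :=
  Cv + a • Fv - ∑ i ∈ s, Ev i

lemma succ_succ_ne_one (i : Fin 6) : i.succ.succ ≠ (1 : Fin 8) :=
  fun h => Fin.succ_ne_zero i (Fin.succ_injective _ h)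

lemma sectionClass_zero (a : ℤ) (s : Finset (Fin 6)) : sectionClass a s 0 = 1 := by
  simp [sectionClass, Cv, Fv, Ev, Finset.sum_apply, (Fin.succ_ne_zero _).symm]

lemma sectionClass_one (a : ℤ) (s : Finset (Fin 6)) : sectionClass a s 1 = a := by
  simp [sectionClass, Cv, Fv, Ev, Finset.sum_apply, (succ_succ_ne_one _).symm]

lemma sectionClass_succ_succ (a : ℤ) (s : Finset (Fin 6)) (i : Fin 6) :
    sectionClass a s i.succ.succ = if i ∈ s then -1 else 0 := by
  simp only [sectionClass, Cv, Fv, Ev, Pi.sub_apply, Pi.add_apply, Pi.smul_apply,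
    Finset.sum_apply, Pi.single_apply, Fin.succ_inj, Fin.succ_ne_zero, succ_succ_ne_one, if_false,
    Finset.sum_ite_eq, smul_zero, add_zero, zero_sub]
  split_ifs <;> rfl

lemma ip_sectionClass_self (a : ℤ) (s : Finset (Fin 6)) :
    ip (sectionClass a s) (sectionClass a s) = 2 * a - s.card := by
  simp [ip, sectionClass_zero, sectionClass_one, sectionClass_succ_succ]
  ring

lemma sectionClass_right_injective {a b : ℤ} {s t : Finset (Fin 6)}
    (h : sectionClass a s = sectionClass b t) : s = t := by
  ext i
  have hi := congrFun h i.succ.succ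
  simp only [sectionClass_succ_succ] at hi
  split_ifs at hi <;> simp_all

lemma sum_smul_Ev (b : Fin 6 → ℤ) (hb : ∀ i, b i = 0 ∨ b i = 1) :
    ∑ i, b i • Ev i = ∑ i with b i = 1, Ev i := by
  rw [Finset.sum_filter]
  refine Finset.sum_congr rfl fun i _ => ?_
  rcases hb i with h | h <;> simp [h]

lemma negSections_eq_image :
    negSections = (fun s : Finset (Fin 6) => sectionClass ((s.card / 2 : ℕ) : ℤ) s) ''
      {s | s.card % 2 = 1} := by
  ext D
  constructor
  · rintro ⟨a, b, hb, rfl, h⟩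
    rw [sum_smul_Ev b hb] at h ⊢
    change ip (sectionClass a _) (sectionClass a _) = -1 at h
    rw [ip_sectionClass_self] at h
    refine ⟨Finset.univ.filter fun i => b i = 1, ?_, ?_⟩
    · simp only [Set.mem_ofPred_eq]
      omega
    · change sectionClass _ _ = sectionClass a _
      congr 1
      omega
  · rintro ⟨s, hs, rfl⟩
    simp only [Set.mem_ofPred_eq] at hs
    refine ⟨s.card / 2, fun i => if i ∈ s then 1 else 0, fun i => ?_, ?_, ?_⟩
    · by_cases h : i ∈ s <;> simp [h]
    · simp [sectionClass]
    · rw [ip_sectionClass_self]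
      omega

lemma card_odd_iff (s : Finset (Fin 6)) : s.card % 2 = 1 ↔
    (∃ i, s = {i}) ∨ (∃ i j k, i < j ∧ j < k ∧ s = {i, j, k}) ∨
      ∃ j, s = Finset.univ.erase j := by
  revert s
  decide

lemma sectionClass_singleton (i : Fin 6) : sectionClass 0 {i} = Cv - Ev i := by
  simp [sectionClass]

lemma sectionClass_triple {i j k : Fin 6} (hij : i < j) (hjk : j < k) :
    sectionClass 1 {i, j, k} = Cv + Fv - Ev i - Ev j - Ev k := by
  rw [sectionClass, Finset.sum_insert (by simp [hij.ne, (hij.trans hjk).ne]),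
    Finset.sum_pair hjk.ne, one_smul]
  abel

lemma sectionClass_erase (j : Fin 6) :
    sectionClass 2 (Finset.univ.erase j) = Cv + (2 : ℤ) • Fv - ∑ i, Ev i + Ev j := by
  rw [sectionClass, ← Finset.add_sum_erase Finset.univ Ev (Finset.mem_univ j)]
  abel

lemma card_triple {i j k : Fin 6} (hij : i < j) (hjk : j < k) :
    ({i, j, k} : Finset (Fin 6)).card = 3 :=
  Finset.card_eq_three.2 ⟨i, j, k, hij.ne, (hij.trans hjk).ne, hjk.ne, rfl⟩

/-- `negSections` consists exactly of the `32` vectors: the six `C − E_i`, the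
twenty `C + F − E_i − E_j − E_k` (`i < j < k`), and the six
`C + 2F − E₁ − ⋯ − E₆ + E_j`. -/
theorem negSections_eq_thirtytwo :
    negSections =
      {D | (∃ i : Fin 6, D = Cv - Ev i) ∨
        (∃ i j k : Fin 6, i < j ∧ j < k ∧ D = Cv + Fv - Ev i - Ev j - Ev k) ∨
        (∃ j : Fin 6, D = Cv + (2 : ℤ) • Fv - ∑ i, Ev i + Ev j)} ∧
    negSections.ncard = 32 := by
  constructor
  · rw [negSections_eq_image]
    ext D
    constructor
    · rintro ⟨s, hs, rfl⟩
      rcases (card_odd_iff s).1 hs with ⟨i, rfl⟩ | ⟨i, j, k, hij, hjk, rfl⟩ | ⟨j, rfl⟩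
      · exact Or.inl ⟨i, by simpa using sectionClass_singleton i⟩
      · exact Or.inr (Or.inl ⟨i, j, k, hij, hjk,
          by simpa [card_triple hij hjk] using sectionClass_triple hij hjk⟩)
      · exact Or.inr (Or.inr ⟨j, by simpa using sectionClass_erase j⟩)
    · rintro (⟨i, rfl⟩ | ⟨i, j, k, hij, hjk, rfl⟩ | ⟨j, rfl⟩)
      · exact ⟨{i}, by simp, by simpa using sectionClass_singleton i⟩
      · exact ⟨{i, j, k}, by simp [card_triple hij hjk],
          by simpa [card_triple hij hjk] using sectionClass_triple hij hjk⟩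
      · exact ⟨Finset.univ.erase j, by simp, by simpa using sectionClass_erase j⟩
  · rw [negSections_eq_image,
      Set.ncard_image_of_injective _ fun s t h => sectionClass_right_injective h]
    have h : {s : Finset (Fin 6) | s.card % 2 = 1} =
        (Finset.univ.filter fun s : Finset (Fin 6) => s.card % 2 = 1 : Set (Finset (Fin 6))) := by
      simp
    rw [h, Set.ncard_coe_finset]
    decide
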